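/- arXiv:1909.04355 — 4 statements merged into one kernel-verified Lean document; each statement's English description precedes it below -/
import Mathlib

section
/- Let C be a nonempty set in a real vector space, let I be a finite index set, and let A_i, B_i : C → ℝ satisfy A_i(x) > 0 and B_i(x) > 0 for all x ∈ C and all i. Then the infimum over x ∈ C of ∑_i B_i(x)/A_i(x) equals the infimum over pairs (x, t) with x ∈ C and t ∈ (0,∞)^I of ∑_i ( t_i·B_i(x)² + 1/(4 t_i·A_i(x)²) ). -/
theorem div_le_fraction_transform {a b t : ℝ} (ha : 0 < a) (ht : 0 < t) :
    b / a ≤ t * b ^ 2 + 1 / (4 * t * a ^ 2) := by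
  have h : t * b ^ 2 + 1 / (4 * t * a ^ 2) - b / a =
      (2 * t * a * b - 1) ^ 2 / (4 * t * a ^ 2) := by
    field_simp
    ring
  have : 0 ≤ (2 * t * a * b - 1) ^ 2 / (4 * t * a ^ 2) := by positivity
  linarith

theorem fraction_transform_eq_div {a b : ℝ} (ha : 0 < a) (hb : 0 < b) :
    1 / (2 * a * b) * b ^ 2 + 1 / (4 * (1 / (2 * a * b)) * a ^ 2) = b / a := by
  field_simp
  ring

/-- Value equality of the sum-of-fractions minimization and its fraction transform. -/
theorem sfmin_fraction_transform_value {V : Type*} [AddCommGroup V] [Module ℝ V]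
    (C : Set V) (hC : C.Nonempty) (I : Type*) [Fintype I]
    (A B : I → V → ℝ)
    (hA : ∀ i, ∀ x ∈ C, 0 < A i x) (hB : ∀ i, ∀ x ∈ C, 0 < B i x) :
    sInf {v : ℝ | ∃ x ∈ C, v = ∑ i, B i x / A i x} =
      sInf {v : ℝ | ∃ x ∈ C, ∃ t : I → ℝ, (∀ i, 0 < t i) ∧
        v = ∑ i, (t i * (B i x) ^ 2 + 1 / (4 * t i * (A i x) ^ 2))} := by
  obtain ⟨x₀, hx₀⟩ := hC
  apply le_antisymm
  · refine le_csInf ⟨_, x₀, hx₀, fun _ => 1, fun _ => one_pos, rfl⟩ ?_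
    rintro _ ⟨x, hx, t, ht, rfl⟩
    refine csInf_le_of_le ⟨0, ?_⟩ ⟨x, hx, rfl⟩
      (Finset.sum_le_sum fun i _ => div_le_fraction_transform (hA i x hx) (ht i))
    rintro _ ⟨y, hy, rfl⟩
    exact Finset.sum_nonneg fun i _ => (div_pos (hB i y hy) (hA i y hy)).le
  · refine le_csInf ⟨_, x₀, hx₀, rfl⟩ ?_
    rintro _ ⟨x, hx, rfl⟩
    refine csInf_le ⟨0, ?_⟩ ⟨x, hx, fun i => 1 / (2 * A i x * B i x), fun i => ?_, ?_⟩
    · rintro _ ⟨y, hy, t, ht, rfl⟩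
      refine Finset.sum_nonneg fun i _ => ?_
      have := ht i
      positivity
    · have := hA i x hx
      have := hB i x hx
      positivity
    · exact Finset.sum_congr rfl fun i _ =>
        (fraction_transform_eq_div (hA i x hx) (hB i x hx)).symm
end

section
/- Let C be a convex set in a real vector space, I a finite index set, and for each i let t_i > 0 be a fixed real number, A_i : C → ℝ be concave with A_i(x) > 0 for all x ∈ C, and B_i : C → ℝ be convex with B_i(x) ≥ 0 for all x ∈ C. Then the function x ↦ ∑_i ( t_i·B_i(x)² + (1/(4 t_i))·(1/A_i(x)²) ) is convex on C. -/
/-- The reciprocal of a positive concave function is convex. -/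
theorem ConcaveOn.convexOn_inv_of_pos {V : Type*} [AddCommGroup V] [Module ℝ V]
    {C : Set V} {f : V → ℝ} (hf : ConcaveOn ℝ C f) (hpos : ∀ x ∈ C, 0 < f x) :
    ConvexOn ℝ C (fun x => (f x)⁻¹) := by
  refine ⟨hf.1, fun x hx y hy a b ha hb hab => ?_⟩
  have hinv : ConvexOn ℝ (Set.Ioi 0) (fun u : ℝ => u⁻¹) := by
    simpa only [zpow_neg_one] using convexOn_zpow (𝕜 := ℝ) (-1)
  have hmem : a • f x + b • f y ∈ Set.Ioi (0 : ℝ) :=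
    hinv.1 (hpos x hx) (hpos y hy) ha hb hab
  calc (f (a • x + b • y))⁻¹ ≤ (a • f x + b • f y)⁻¹ :=
        inv_anti₀ hmem (hf.2 hx hy ha hb hab)
    _ ≤ a • (f x)⁻¹ + b • (f y)⁻¹ := hinv.2 (hpos x hx) (hpos y hy) ha hb hab

/-- A finite sum of convex functions on a convex set is convex. -/
theorem convexOn_finset_sum {V ι : Type*} [AddCommGroup V] [Module ℝ V]
    {C : Set V} (hC : Convex ℝ C) (s : Finset ι) {f : ι → V → ℝ}
    (hf : ∀ i ∈ s, ConvexOn ℝ C (f i)) : ConvexOn ℝ C (fun x => ∑ i ∈ s, f i x) := by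
  refine ⟨hC, fun x hx y hy a b ha hb hab => ?_⟩
  rw [Finset.smul_sum, Finset.smul_sum, ← Finset.sum_add_distrib]
  exact Finset.sum_le_sum fun i hi => (hf i hi).2 hx hy ha hb hab


/-- For fixed positive `t`, the fraction-transformed objective is convex in `x`
when each `A_i` is concave and positive and each `B_i` is convex and nonnegative. -/
theorem transform_objective_convexOn {V : Type*} [AddCommGroup V] [Module ℝ V]
    (C : Set V) (hC : Convex ℝ C) (I : Type*) [Fintype I]
    (t : I → ℝ) (ht : ∀ i, 0 < t i)
    (A B : I → V → ℝ)
    (hA : ∀ i, ConcaveOn ℝ C (A i)) (hApos : ∀ i, ∀ x ∈ C, 0 < A i x)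
    (hB : ∀ i, ConvexOn ℝ C (B i)) (hBnonneg : ∀ i, ∀ x ∈ C, 0 ≤ B i x) :
    ConvexOn ℝ C
      (fun x => ∑ i, (t i * (B i x) ^ 2 + (1 / (4 * t i)) * (1 / (A i x) ^ 2))) := by
  refine convexOn_finset_sum hC Finset.univ fun i _ => ?_
  have hB2 := ((hB i).pow (fun x hx => hBnonneg i x hx) 2).smul (ht i).le
  have hA2 := (((hA i).convexOn_inv_of_pos (hApos i)).pow
    (fun x hx => (inv_pos.2 (hApos i x hx)).le) 2).smul
    (one_div_pos.2 (mul_pos four_pos (ht i))).le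
  refine (hB2.add hA2).congr fun x _ => ?_
  simp
end

section
/- Let C be a nonempty set in a real vector space, M a finite index set, and for each m let a_m, b_m : C → ℝ satisfy a_m(x) > 0 and b_m(x) > 0 for all x ∈ C, and let f_m : ℝ → ℝ be antitone (decreasing). Then the infimum over x ∈ C of ∑_m f_m(a_m(x)/b_m(x)) equals the infimum over pairs (x, y) with x ∈ C and y ∈ ℝ^M of ∑_m f_m( 2 y_m·√(a_m(x)) − y_m²·b_m(x) ). -/
theorem quadratic_transform_le {a b : ℝ} (ha : 0 ≤ a) (hb : 0 < b) (y : ℝ) :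
    2 * y * Real.sqrt a - y ^ 2 * b ≤ a / b := by
  rw [le_div_iff₀ hb]
  nlinarith [sq_nonneg (Real.sqrt a - y * b), Real.sq_sqrt ha]

theorem quadratic_transform_eq {a b : ℝ} (ha : 0 ≤ a) (hb : b ≠ 0) :
    2 * (Real.sqrt a / b) * Real.sqrt a - (Real.sqrt a / b) ^ 2 * b = a / b := by
  field_simp
  rw [Real.sq_sqrt ha]
  ring


/-- Corollary 1 of the paper: for decreasing outer functions `f_m`, minimizing
`∑ f_m (a_m x / b_m x)` is equivalent (in value) to the joint minimization over
`x` and auxiliary variables `y` of `∑ f_m (2 y_m √(a_m x) − y_m² b_m x)`. -/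
theorem quadratic_transform_value {V : Type*} [AddCommGroup V] [Module ℝ V]
    (C : Set V) (hC : C.Nonempty) (M : Type*) [Fintype M]
    (a b : M → V → ℝ)
    (ha : ∀ m, ∀ x ∈ C, 0 < a m x) (hb : ∀ m, ∀ x ∈ C, 0 < b m x)
    (f : M → ℝ → ℝ) (hf : ∀ m, Antitone (f m)) :
    sInf {v : ℝ | ∃ x ∈ C, v = ∑ m, f m (a m x / b m x)} =
      sInf {v : ℝ | ∃ x ∈ C, ∃ y : M → ℝ,
        v = ∑ m, f m (2 * y m * Real.sqrt (a m x) - (y m) ^ 2 * b m x)} := by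
  apply csInf_eq_csInf_of_forall_exists_le
  · rintro _ ⟨x, hx, rfl⟩
    refine ⟨_, ⟨x, hx, fun m => Real.sqrt (a m x) / b m x, rfl⟩, ?_⟩
    exact (Finset.sum_congr rfl fun m _ =>
      congrArg (f m) (quadratic_transform_eq (ha m x hx).le (hb m x hx).ne')).le
  · rintro _ ⟨x, hx, y, rfl⟩
    refine ⟨_, ⟨x, hx, rfl⟩, ?_⟩
    exact Finset.sum_le_sum fun m _ =>
      hf m (quadratic_transform_le (ha m x hx).le (hb m x hx) (y m))
end

section
/- Let S be a set of pairs of positive real numbers. Suppose (x₁, y₁) ∈ S maximizes x + y over S and (x₂, y₂) ∈ S minimizes 1/x + 1/y over S, and suppose x₁ ≥ y₁ and x₂ ≥ y₂. Then x₁/y₁ ≥ x₂/y₂. -/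
/-- Fairness of sum-of-inverse minimization: over a common feasible set `S` of
pairs of positive reals, the component ratio at the sum-of-inverse minimizer
never exceeds that at the sum maximizer. -/
theorem simin_fairness (S : Set (ℝ × ℝ)) (hpos : ∀ p ∈ S, 0 < p.1 ∧ 0 < p.2)
    (x₁ y₁ x₂ y₂ : ℝ)
    (h₁S : (x₁, y₁) ∈ S) (h₂S : (x₂, y₂) ∈ S)
    (hmax : ∀ p ∈ S, p.1 + p.2 ≤ x₁ + y₁)
    (hmin : ∀ p ∈ S, 1 / x₂ + 1 / y₂ ≤ 1 / p.1 + 1 / p.2)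
    (hord₁ : x₁ ≥ y₁) (hord₂ : x₂ ≥ y₂) :
    x₁ / y₁ ≥ x₂ / y₂ := by
  obtain ⟨hx₁, hy₁⟩ : 0 < x₁ ∧ 0 < y₁ := hpos _ h₁S
  obtain ⟨hx₂, hy₂⟩ : 0 < x₂ ∧ 0 < y₂ := hpos _ h₂S
  have hsum : x₂ + y₂ ≤ x₁ + y₁ := hmax _ h₂S
  have hinv : 1 / x₂ + 1 / y₂ ≤ 1 / x₁ + 1 / y₁ := hmin _ h₁S
  rw [div_add_div _ _ hx₂.ne' hy₂.ne', div_add_div _ _ hx₁.ne' hy₁.ne',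
    div_le_div_iff₀ (by positivity) (by positivity)] at hinv
  rw [ge_iff_le, div_le_div_iff₀ hy₂ hy₁]
  by_contra! hlt
  have hxy₂ : y₂ < x₂ := by
    have : y₁ * y₂ ≤ x₁ * y₂ := by gcongr
    nlinarith
  have hprod : y₁ * y₂ < x₁ * x₂ := by
    calc y₁ * y₂ < y₁ * x₂ := by gcongr
      _ ≤ x₁ * x₂ := by gcongr
  have hleft : (x₂ + y₂) * ((x₂ + y₂) * (x₁ * y₁)) ≤ (x₂ + y₂) * ((x₁ + y₁) * (x₂ * y₂)) :=
    mul_le_mul_of_nonneg_left (by linarith) (by positivity)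
  have hright : (x₂ + y₂) * ((x₁ + y₁) * (x₂ * y₂)) ≤ (x₁ + y₁) * ((x₁ + y₁) * (x₂ * y₂)) := by
    gcongr
  linarith [mul_pos (sub_pos.2 hprod) (sub_pos.2 hlt)]
end
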